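/- Let A be a commutative Noetherian ring of Krull dimension d and P a finitely generated projective A-module of rank > d. Then the group E(A ⊕ P) generated by transvections acts transitively on the set Um(A ⊕ P) of unimodular elements of A ⊕ P. -/

import Mathlib

/-- The elementary subgroup `E(A ⊕ P)` of `Aut(A ⊕ P)` generated by the
transvections `Δ_q : (b, q') ↦ (b, q' + b • q)` and `Γ_α : (b, q') ↦ (b + α q', q')`. -/
def elementarySubgroup (A : Type*) [CommRing A] (P : Type*) [AddCommGroup P]
    [Module A P] : Subgroup ((A × P) ≃ₗ[A] (A × P)) :=
  Subgroup.closure {e | (∃ q : P, ∀ x : A × P, e x = (x.1, x.2 + x.1 • q)) ∨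
    (∃ α : P →ₗ[A] A, ∀ x : A × P, e x = (x.1 + α x.2, x.2))}

section

open Module

/-- The residue of a vector of `A^ι` at the prime `𝔭`. -/
noncomputable def fiberVec {A : Type*} [CommRing A] (𝔭 : PrimeSpectrum A) (ι : Type*) :
    (ι → A) →ₗ[A] (ι → 𝔭.asIdeal.ResidueField) :=
  (Algebra.linearMap A 𝔭.asIdeal.ResidueField).compLeft ι

/-- The span over the residue field at `𝔭` of the residues of a family of vectors. -/
noncomputable def fiberSpan {A : Type*} [CommRing A] (𝔭 : PrimeSpectrum A) {σ ι : Type*}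
    (m : σ → ι → A) : Submodule 𝔭.asIdeal.ResidueField (ι → 𝔭.asIdeal.ResidueField) :=
  Submodule.span _ (Set.range fun i ↦ fiberVec 𝔭 ι (m i))

/-- The dimension of the fiber at `𝔭` of a family of vectors. -/
noncomputable def fiberRank {A : Type*} [CommRing A] (𝔭 : PrimeSpectrum A) {σ ι : Type*}
    (m : σ → ι → A) : ℕ :=
  finrank 𝔭.asIdeal.ResidueField (fiberSpan 𝔭 m)

section

variable {A : Type*} [CommRing A] {σ ι : Type*}

@[simp] lemma fiberVec_apply (𝔭 : PrimeSpectrum A) (v : ι → A) (j : ι) :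
    fiberVec 𝔭 ι v j = algebraMap A 𝔭.asIdeal.ResidueField (v j) := rfl

lemma fiberVec_smul (𝔭 : PrimeSpectrum A) (c : A) (v : ι → A) :
    fiberVec 𝔭 ι (c • v) = algebraMap A 𝔭.asIdeal.ResidueField c • fiberVec 𝔭 ι v := by
  ext j; simp

lemma fiberVec_eq_zero_iff (𝔭 : PrimeSpectrum A) (v : ι → A) :
    fiberVec 𝔭 ι v = 0 ↔ ∀ j, v j ∈ 𝔭.asIdeal := by
  simp [funext_iff, Ideal.algebraMap_residueField_eq_zero]

/-- A finite family of residues has a common denominator. -/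
lemma exists_common_denominator (𝔭 : PrimeSpectrum A) {τ : Type*} [Finite τ]
    (x : τ → 𝔭.asIdeal.ResidueField) :
    ∃ s ∉ 𝔭.asIdeal, ∃ y : τ → A, ∀ i, algebraMap A 𝔭.asIdeal.ResidueField (y i) =
      algebraMap A 𝔭.asIdeal.ResidueField s * x i := by
  obtain ⟨⟨b, hb⟩, h⟩ := IsLocalization.exist_integer_multiples_of_finite
    (nonZeroDivisors (A ⧸ 𝔭.asIdeal)) x
  obtain ⟨s, rfl⟩ := Ideal.Quotient.mk_surjective b
  refine ⟨s, fun hs ↦ nonZeroDivisors.ne_zero hb (Ideal.Quotient.eq_zero_iff_mem.2 hs), ?_⟩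
  choose z hz using h
  choose y hy using fun i ↦ Ideal.Quotient.mk_surjective (z i)
  refine ⟨y, fun i ↦ ?_⟩
  have := hz i
  rw [← hy i] at this
  simpa [Algebra.smul_def] using this

/-- The fiber dimension is lower semicontinuous. -/
lemma exists_notMem_forall_fiberRank_le [Finite σ] [Finite ι] (𝔭 : PrimeSpectrum A)
    (m : σ → ι → A) :
    ∃ g ∉ 𝔭.asIdeal, ∀ 𝔮 : PrimeSpectrum A, g ∉ 𝔮.asIdeal → fiberRank 𝔭 m ≤ fiberRank 𝔮 m := by
  classical
  have := Fintype.ofFinite ι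
  obtain ⟨κ, a, ha, hsp, hli⟩ := exists_linearIndependent' 𝔭.asIdeal.ResidueField
    (fun i ↦ fiberVec 𝔭 ι (m i))
  have : Finite κ := Finite.of_injective a ha
  have := Fintype.ofFinite κ
  have hcard : fiberRank 𝔭 m = Fintype.card κ := by
    rw [fiberRank, fiberSpan, ← hsp, finrank_span_eq_card hli]
  obtain ⟨l, hl⟩ := (Fintype.linearCombination 𝔭.asIdeal.ResidueField
    ((fun i ↦ fiberVec 𝔭 ι (m i)) ∘ a)).exists_leftInverse_of_injective
    (LinearMap.ker_eq_bot.2 hli.fintypeLinearCombination_injective)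
  obtain ⟨s, hs, y, hy⟩ := exists_common_denominator 𝔭
    (fun p : ι × κ ↦ l (fun j ↦ if p.1 = j then 1 else 0) p.2)
  let M : Matrix κ ι A := Matrix.of fun k j ↦ m (a k) j
  let C : Matrix ι κ A := Matrix.of fun j k ↦ y (j, k)
  have key : (algebraMap A 𝔭.asIdeal.ResidueField).mapMatrix (M * C) =
      algebraMap A 𝔭.asIdeal.ResidueField s • 1 := by
    ext k k'
    have h1 : l (fiberVec 𝔭 ι (m (a k))) k' = (1 : Matrix κ κ 𝔭.asIdeal.ResidueField) k k' := by
      have := congr_fun (LinearMap.congr_fun hl (Pi.single k 1)) k'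
      simpa [Fintype.linearCombination_apply_single, Matrix.one_apply, Pi.single_apply, eq_comm]
        using this
    rw [RingHom.mapMatrix_apply, Matrix.map_apply, Matrix.smul_apply, ← h1,
      LinearMap.pi_apply_eq_sum_univ l]
    simp [M, C, Matrix.mul_apply, hy, Finset.mul_sum, Algebra.smul_def, mul_left_comm]
  refine ⟨(M * C).det, fun hdet ↦ ?_, fun 𝔮 h𝔮 ↦ ?_⟩
  · rw [← Ideal.algebraMap_residueField_eq_zero, RingHom.map_det, key, Matrix.det_smul] at hdet
    simp [Ideal.algebraMap_residueField_eq_zero, hs] at hdet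
  · have hli' : LinearIndependent 𝔮.asIdeal.ResidueField (fun k ↦ fiberVec 𝔮 ι (m (a k))) := by
      rw [← Ideal.algebraMap_residueField_eq_zero, RingHom.map_det, RingHom.mapMatrix_apply,
        Matrix.map_mul] at h𝔮
      have hu := (Matrix.isUnit_iff_isUnit_det _).2 (isUnit_iff_ne_zero.2 h𝔮)
      have hinj := Matrix.vecMul_injective_of_isUnit hu
      have : Function.Injective (M.map (algebraMap A 𝔮.asIdeal.ResidueField)).vecMul := by
        intro x y hxy
        apply hinj
        simp only [← Matrix.vecMul_vecMul, hxy]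
      exact Matrix.vecMul_injective_iff.1 this
    rw [hcard, ← finrank_span_eq_card hli', fiberRank]
    apply Submodule.finrank_mono
    exact Submodule.span_mono (by rintro _ ⟨k, rfl⟩; exact ⟨a k, rfl⟩)

/-- Primes minimal in a sublevel set of the fiber dimension are finite in number. -/
lemma finite_setOf_minimal_fiberRank_le [IsNoetherianRing A] [Finite σ] [Finite ι]
    (m : σ → ι → A) (r : ℕ) :
    {𝔭 : PrimeSpectrum A | Minimal (fun 𝔮 ↦ fiberRank 𝔮 m ≤ r) 𝔭}.Finite := by
  have hcl : IsClosed {𝔭 : PrimeSpectrum A | fiberRank 𝔭 m ≤ r} := by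
    rw [← isOpen_compl_iff, isOpen_iff_forall_mem_open]
    intro 𝔭 h𝔭
    obtain ⟨g, hg, h⟩ := exists_notMem_forall_fiberRank_le 𝔭 m
    refine ⟨PrimeSpectrum.basicOpen g, fun 𝔮 h𝔮 hr ↦ h𝔭 ((h 𝔮 h𝔮).trans hr),
      (PrimeSpectrum.basicOpen g).2, hg⟩
  obtain ⟨I, hI⟩ := (PrimeSpectrum.isClosed_iff_zeroLocus_ideal _).1 hcl
  have hmem (𝔮 : PrimeSpectrum A) : fiberRank 𝔮 m ≤ r ↔ I ≤ 𝔮.asIdeal :=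
    Set.ext_iff.1 hI 𝔮
  refine ((I.finite_minimalPrimes_of_isNoetherianRing A).preimage
    (fun x _ y _ h ↦ PrimeSpectrum.ext h)).subset fun 𝔭 h𝔭 ↦ ?_
  refine ⟨⟨𝔭.2, (hmem 𝔭).1 h𝔭.1⟩, fun J hJ hle ↦ ?_⟩
  exact h𝔭.2 (y := ⟨J, hJ.1⟩) ((hmem _).2 hJ.2) hle

/-- Finitely many conditions, each depending only on the residues at one prime and each solvable
by a perturbation divisible by any given element outside that prime, are solvable at once. -/
lemma exists_forall_of_perturb {M : Type*} [AddCommGroup M] [Module A M]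
    (F : Finset (PrimeSpectrum A)) (G : PrimeSpectrum A → M → Prop)
    (hcongr : ∀ 𝔭 ∈ F, ∀ b t, ∀ s ∈ 𝔭.asIdeal, G 𝔭 b → G 𝔭 (b + s • t))
    (hpert : ∀ 𝔭 ∈ F, ∀ b, ∀ s ∉ 𝔭.asIdeal, ∃ t, G 𝔭 (b + s • t)) :
    ∃ b, ∀ 𝔭 ∈ F, G 𝔭 b := by
  classical
  induction hn : F.card generalizing F with
  | zero => exact ⟨0, by simp [Finset.card_eq_zero.1 hn]⟩
  | succ n ih =>
    obtain ⟨𝔭, h𝔭⟩ := F.exists_minimal (Finset.card_pos.1 (by omega))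
    obtain ⟨b, hb⟩ := ih (F.erase 𝔭) (fun 𝔮 h ↦ hcongr 𝔮 (Finset.mem_of_mem_erase h))
      (fun 𝔮 h ↦ hpert 𝔮 (Finset.mem_of_mem_erase h))
      (by rw [Finset.card_erase_of_mem h𝔭.1]; omega)
    have hs : ¬ (F.erase 𝔭).inf PrimeSpectrum.asIdeal ≤ 𝔭.asIdeal := by
      intro hle
      obtain ⟨𝔮, h𝔮, hle⟩ := (Ideal.IsPrime.inf_le' 𝔭.2).1 hle
      obtain ⟨hne, h𝔮F⟩ := Finset.mem_erase.1 h𝔮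
      exact hne (le_antisymm hle (h𝔭.2 h𝔮F hle))
    obtain ⟨s, hs, hs𝔭⟩ := SetLike.not_le_iff_exists.1 hs
    obtain ⟨t, ht⟩ := hpert 𝔭 h𝔭.1 b s hs𝔭
    refine ⟨b + s • t, fun 𝔮 h𝔮 ↦ ?_⟩
    rcases eq_or_ne 𝔮 𝔭 with rfl | hne
    · exact ht
    · have h := Finset.mem_erase.2 ⟨hne, h𝔮⟩
      exact hcongr 𝔮 h𝔮 b t s (Finset.inf_le (f := PrimeSpectrum.asIdeal) h hs) (hb 𝔮 h)
/-- The family `m i + c i • m u` for `i < u`, obtained by absorbing the last vector of `m`. -/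
def absorbLast {u : ℕ} (m : Fin (u + 1) → ι → A) (c : Fin u → A) : Fin u → ι → A :=
  fun i ↦ m i.castSucc + c i • m (Fin.last u)

lemma absorbLast_mem_span {u : ℕ} (m : Fin (u + 1) → ι → A) (c : Fin u → A) (i : Fin u) :
    absorbLast m c i ∈ Submodule.span A (Set.range m) :=
  add_mem (Submodule.subset_span ⟨_, rfl⟩)
    (Submodule.smul_mem _ _ (Submodule.subset_span ⟨_, rfl⟩))

lemma fiberVec_absorbLast (𝔭 : PrimeSpectrum A) {u : ℕ} (m : Fin (u + 1) → ι → A)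
    (c : Fin u → A) (i : Fin u) :
    fiberVec 𝔭 ι (absorbLast m c i) = fiberVec 𝔭 ι (m i.castSucc) +
      algebraMap A 𝔭.asIdeal.ResidueField (c i) • fiberVec 𝔭 ι (m (Fin.last u)) := by
  rw [absorbLast, map_add, fiberVec_smul]

lemma fiberSpan_le_absorbLast (𝔭 : PrimeSpectrum A) {u : ℕ} (m : Fin (u + 1) → ι → A)
    (c : Fin u → A) :
    fiberSpan 𝔭 m ≤ fiberSpan 𝔭 (absorbLast m c) ⊔
      Submodule.span 𝔭.asIdeal.ResidueField {fiberVec 𝔭 ι (m (Fin.last u))} := by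
  have hlast := Submodule.mem_sup_right (S := fiberSpan 𝔭 (absorbLast m c))
    (Submodule.mem_span_singleton_self (R := 𝔭.asIdeal.ResidueField) (fiberVec 𝔭 ι (m (Fin.last u))))
  refine Submodule.span_le.2 ?_
  rintro _ ⟨i, rfl⟩
  induction i using Fin.lastCases with
  | last => exact hlast
  | cast i =>
    have h : fiberVec 𝔭 ι (absorbLast m c i) ∈ fiberSpan 𝔭 (absorbLast m c) :=
      Submodule.subset_span ⟨i, rfl⟩
    have h' := sub_mem (Submodule.mem_sup_left h) (Submodule.smul_mem _
      (algebraMap A 𝔭.asIdeal.ResidueField (c i)) hlast)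
    rwa [fiberVec_absorbLast, add_sub_cancel_right] at h'

lemma fiberRank_le_absorbLast_add_one [Finite ι] (𝔭 : PrimeSpectrum A) {u : ℕ}
    (m : Fin (u + 1) → ι → A) (c : Fin u → A) :
    fiberRank 𝔭 m ≤ fiberRank 𝔭 (absorbLast m c) + 1 := by
  refine (Submodule.finrank_mono (fiberSpan_le_absorbLast 𝔭 m c)).trans
    ((Submodule.finrank_add_le_finrank_add_finrank _ _).trans
      (Nat.add_le_add_left ?_ _))
  exact (finrank_span_le_card _).trans (by simp)

/-- A linear relation among the residues of `m` bounds the fiber dimension after absorption. -/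
lemma fiberRank_le_absorbLast [Finite ι] (𝔭 : PrimeSpectrum A) {u : ℕ}
    (m : Fin (u + 1) → ι → A) (c : Fin u → A) (l : Fin (u + 1) → 𝔭.asIdeal.ResidueField)
    (hl : ∑ i, l i • fiberVec 𝔭 ι (m i) = 0)
    (hc : ∑ i : Fin u, l i.castSucc * algebraMap A _ (c i) ≠ l (Fin.last u)) :
    fiberRank 𝔭 m ≤ fiberRank 𝔭 (absorbLast m c) := by
  refine Submodule.finrank_mono ((fiberSpan_le_absorbLast 𝔭 m c).trans (sup_le le_rfl ?_))
  rw [Submodule.span_singleton_le_iff_mem]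
  have h : ∑ i : Fin u, l i.castSucc • fiberVec 𝔭 ι (absorbLast m c i) ∈
      fiberSpan 𝔭 (absorbLast m c) :=
    sum_mem fun i _ ↦ Submodule.smul_mem _ _ (Submodule.subset_span ⟨i, rfl⟩)
  rw [Fin.sum_univ_castSucc] at hl
  have hval : ∑ i : Fin u, l i.castSucc • fiberVec 𝔭 ι (absorbLast m c i) =
      (∑ i : Fin u, l i.castSucc * algebraMap A _ (c i) - l (Fin.last u)) •
        fiberVec 𝔭 ι (m (Fin.last u)) := by
    simp only [fiberVec_absorbLast, smul_add, Finset.sum_add_distrib, smul_smul, sub_smul,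
      Finset.sum_smul]
    rw [eq_neg_of_add_eq_zero_left hl]
    abel
  rw [hval] at h
  exact (Submodule.smul_mem_iff _ (sub_ne_zero.2 hc)).1 h

/-- At a prime where the residues are dependent, absorption preserves the fiber dimension for some
coefficients, the zeroth of which is divisible by `w 0`. -/
lemma exists_fiberRank_le_absorbLast [Finite ι] (𝔭 : PrimeSpectrum A) {u : ℕ}
    (m : Fin (u + 2) → ι → A) (w : Fin (u + 1) → A) (hw1 : ∀ i : Fin u, w i.succ = 1)
    (hw0 : w 0 ∈ 𝔭.asIdeal → ∃ j, m 0 j ∉ 𝔭.asIdeal)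
    (hr : fiberRank 𝔭 m ≤ u + 1) (b : Fin (u + 1) → A) (s : A) (hs : s ∉ 𝔭.asIdeal) :
    ∃ t : Fin (u + 1) → A, fiberRank 𝔭 m ≤
      fiberRank 𝔭 (absorbLast m (w * (b + s • t))) := by
  have hdep : ¬ LinearIndependent 𝔭.asIdeal.ResidueField (fun i ↦ fiberVec 𝔭 ι (m i)) := by
    intro h
    have := finrank_span_eq_card h
    rw [fiberRank, fiberSpan, this, Fintype.card_fin] at hr
    omega
  obtain ⟨l, hl, i₀, hi₀⟩ := Fintype.not_linearIndependent_iff.1 hdep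
  by_contra! hcon
  replace hcon (t) := not_imp_comm.1
    (fiberRank_le_absorbLast 𝔭 m (w * (b + s • t)) l hl) (hcon t).not_ge
  rw [← Ideal.algebraMap_residueField_eq_zero] at hs
  have h0 := hcon 0
  have hw (i : Fin (u + 1)) : l i.castSucc * algebraMap A _ (w i)
      = 0 := by
    have h1 := hcon (Pi.single i 1)
    rw [← h0, ← sub_eq_zero, ← Finset.sum_sub_distrib, Finset.sum_eq_single i] at h1
    · simp only [Pi.mul_apply, Pi.add_apply, Pi.smul_apply, Pi.single_eq_same, Pi.zero_apply,
        map_mul, map_add, smul_eq_mul, mul_one, mul_zero, add_zero, ← mul_sub,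
        add_sub_cancel_left, ← mul_assoc] at h1
      exact (mul_eq_zero.1 h1).resolve_right hs
    · intro j _ hj
      simp [hj]
    · simp
  have hlast : l (Fin.last (u + 1)) = 0 := by
    rw [← h0]
    refine Finset.sum_eq_zero fun i _ ↦ ?_
    rw [Pi.mul_apply, map_mul, ← mul_assoc, hw, zero_mul]
  have hsucc (i : Fin u) : l i.succ.castSucc = 0 := by simpa [hw1] using hw i.succ
  have hz (i : Fin (u + 2)) (hi : i ≠ 0) : l i = 0 := by
    induction i using Fin.lastCases with
    | last => exact hlast
    | cast i =>
      induction i using Fin.cases with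
      | zero => exact absurd rfl hi
      | succ i => exact hsucc i
  have hl0 : l 0 ≠ 0 := by
    rcases eq_or_ne i₀ 0 with rfl | h
    · exact hi₀
    · exact absurd (hz _ h) hi₀
  have ha0 := (mul_eq_zero.1 (hw 0)).resolve_left hl0
  rw [Ideal.algebraMap_residueField_eq_zero] at ha0
  obtain ⟨j, hj⟩ := hw0 ha0
  rw [Finset.sum_eq_single 0 (fun i _ hi ↦ by rw [hz i hi, zero_smul]) (by simp)] at hl
  exact hj ((fiberVec_eq_zero_iff 𝔭 _).1 ((smul_eq_zero.1 hl).resolve_left hl0) j)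

/-- If the fiber dimensions of `m` are large with respect to a strictly antitone function `δ`,
then `m 0` can be modified by a multiple of `a` so as not to vanish at any prime. -/
theorem exists_forall_add_smul_notMem [IsNoetherianRing A] [Finite ι] (δ : PrimeSpectrum A → ℕ)
    (hδ : StrictAnti δ) (hpos : ∀ 𝔭, 0 < δ 𝔭) (a : A) {u : ℕ} (m : Fin (u + 1) → ι → A)
    (ha : ∀ 𝔭 : PrimeSpectrum A, a ∈ 𝔭.asIdeal → ∃ j, m 0 j ∉ 𝔭.asIdeal)
    (hm : ∀ 𝔭, min (u + 1) (δ 𝔭) ≤ fiberRank 𝔭 m) :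
    ∃ w ∈ Submodule.span A (Set.range m), ∀ 𝔭 : PrimeSpectrum A,
      ∃ j, (m 0 + a • w) j ∉ 𝔭.asIdeal := by
  induction u with
  | zero =>
    refine ⟨0, zero_mem _, fun 𝔭 ↦ ?_⟩
    by_contra! h
    have h0 : fiberVec 𝔭 ι (m 0) = 0 := (fiberVec_eq_zero_iff _ _).2 (by simpa using h)
    have h1 : fiberSpan 𝔭 m = ⊥ := by
      rw [fiberSpan, Submodule.span_eq_bot]
      rintro _ ⟨i, rfl⟩
      rwa [Fin.fin_one_eq_zero i]
    have := hm 𝔭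
    rw [fiberRank, h1, finrank_bot] at this
    have := hpos 𝔭
    omega
  | succ u ih =>
    have hfin : {𝔭 | fiberRank 𝔭 m ≤ u + 1 ∧ fiberRank 𝔭 m ≤ δ 𝔭}.Finite := by
      refine ((Set.finite_Iic (u + 1)).biUnion
        fun r _ ↦ finite_setOf_minimal_fiberRank_le m r).subset ?_
      rintro 𝔭 ⟨h1, h2⟩
      refine Set.mem_biUnion (x := fiberRank 𝔭 m) h1 ⟨le_rfl, fun 𝔮 h𝔮 hle ↦ ?_⟩
      rcases hle.eq_or_lt with rfl | hlt
      · exact le_rfl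
      · have := hδ hlt
        have := hm 𝔮
        dsimp only at h𝔮
        omega
    obtain ⟨w, hw0, hw1⟩ : ∃ w : Fin (u + 1) → A, w 0 = a ∧ ∀ i : Fin u, w i.succ = 1 :=
      ⟨Fin.cons a 1, rfl, fun _ ↦ rfl⟩
    obtain ⟨b, hb⟩ := exists_forall_of_perturb hfin.toFinset
      (fun 𝔭 (b : Fin (u + 1) → A) ↦
        fiberRank 𝔭 m ≤ fiberRank 𝔭 (absorbLast m (w * b)))
      (fun 𝔭 _ b t s hs h ↦ by
        have : (fun i ↦ fiberVec 𝔭 ι (absorbLast m (w * (b + s • t)) i)) =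
            fun i ↦ fiberVec 𝔭 ι (absorbLast m (w * b) i) := by
          rw [← Ideal.algebraMap_residueField_eq_zero] at hs
          ext1 i
          simp only [fiberVec_absorbLast, Pi.mul_apply, Pi.add_apply, Pi.smul_apply, smul_eq_mul,
            map_mul, map_add, hs, zero_mul, add_zero]
        rwa [fiberRank, fiberRank, fiberSpan, fiberSpan, this])
      (fun 𝔭 h𝔭 b s hs ↦ exists_fiberRank_le_absorbLast 𝔭 m w hw1
        (by rw [hw0]; exact ha 𝔭)
        (hfin.mem_toFinset.1 h𝔭).1 b s hs)
    have hm0 : absorbLast m (w * b) 0 = m 0 + a • b 0 • m (Fin.last _) := by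
      simp [absorbLast, smul_smul, hw0]
    obtain ⟨v, hv, h⟩ := ih (absorbLast m (w * b))
      (fun 𝔭 h𝔭 ↦ by
        obtain ⟨j, hj⟩ := ha 𝔭 h𝔭
        refine ⟨j, fun h ↦ hj ?_⟩
        rw [hm0] at h
        exact (Ideal.add_mem_iff_left _ (Ideal.mul_mem_right _ _ h𝔭)).1 h)
      (fun 𝔭 ↦ by
        have h1 := hm 𝔭
        by_cases hbad : fiberRank 𝔭 m ≤ u + 1 ∧ fiberRank 𝔭 m ≤ δ 𝔭
        · have := hb 𝔭 (hfin.mem_toFinset.2 hbad)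
          omega
        · have := fiberRank_le_absorbLast_add_one 𝔭 m (w * b)
          omega)
    refine ⟨b 0 • m (Fin.last _) + v, add_mem
      (Submodule.smul_mem _ _ (Submodule.subset_span ⟨_, rfl⟩)) ?_, fun 𝔭 ↦ ?_⟩
    · refine Submodule.span_le.2 ?_ hv
      rintro _ ⟨i, rfl⟩
      exact absorbLast_mem_span m _ i
    · obtain ⟨j, hj⟩ := h 𝔭
      refine ⟨j, ?_⟩
      rwa [hm0, add_assoc, ← smul_add] at hj

/-- The fiber dimension of a module embedded by `g` in `A^ι` is at most that of the image of any
generating family. -/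
lemma finrank_fiber_le_fiberRank {P : Type*} [AddCommGroup P] [Module A P] [Finite ι]
    (𝔭 : PrimeSpectrum A) (f : (ι → A) →ₗ[A] P) (g : P →ₗ[A] (ι → A))
    (hfg : f ∘ₗ g = LinearMap.id) (m : σ → ι → A) (hm : ∀ x, g x ∈ Submodule.span A (Set.range m)) :
    finrank 𝔭.asIdeal.ResidueField (𝔭.asIdeal.Fiber P) ≤ fiberRank 𝔭 m := by
  classical
  have := Fintype.ofFinite ι
  let e := TensorProduct.piScalarRight A 𝔭.asIdeal.ResidueField 𝔭.asIdeal.ResidueField ι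
  let h : 𝔭.asIdeal.Fiber P →ₗ[𝔭.asIdeal.ResidueField] (ι → 𝔭.asIdeal.ResidueField) :=
    e.toLinearMap ∘ₗ g.baseChange 𝔭.asIdeal.ResidueField
  have hinj : Function.Injective h := by
    refine e.injective.comp (Function.LeftInverse.injective
      (g := f.baseChange 𝔭.asIdeal.ResidueField) fun x ↦ ?_)
    rw [← LinearMap.comp_apply, ← LinearMap.baseChange_comp, hfg, LinearMap.baseChange_id,
      LinearMap.id_apply]
  have htmul (c : 𝔭.asIdeal.ResidueField) (x : P) :
      h (TensorProduct.tmul A c x) = c • fiberVec 𝔭 ι (g x) := by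
    ext j
    simp [h, e, Algebra.smul_def, mul_comm]
  have hspan (v : ι → A) (hv : v ∈ Submodule.span A (Set.range m)) :
      fiberVec 𝔭 ι v ∈ fiberSpan 𝔭 m := by
    have : Submodule.span A (Set.range m) ≤
        ((fiberSpan 𝔭 m).restrictScalars A).comap (fiberVec 𝔭 ι) :=
      Submodule.span_le.2 (by rintro _ ⟨i, rfl⟩; exact Submodule.subset_span ⟨i, rfl⟩)
    exact this hv
  rw [← LinearMap.finrank_range_of_inj hinj]
  refine Submodule.finrank_mono ?_
  rintro _ ⟨z, rfl⟩
  induction z using TensorProduct.induction_on with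
  | zero => rw [map_zero]; exact zero_mem _
  | tmul c x => rw [htmul]; exact Submodule.smul_mem _ _ (hspan _ (hm x))
  | add x y hx hy => rw [map_add]; exact add_mem hx hy

/-- In dimension `d`, the function `d + 1 - height` on the spectrum is positive and strictly
antitone. -/
lemma exists_strictAnti_of_ringKrullDim_eq {d : ℕ} (hdim : ringKrullDim A = d) :
    ∃ δ : PrimeSpectrum A → ℕ, StrictAnti δ ∧ (∀ 𝔭, 0 < δ 𝔭) ∧ ∀ 𝔭, δ 𝔭 ≤ d + 1 := by
  have hle (𝔭 : PrimeSpectrum A) : Order.height 𝔭 ≤ d := by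
    have := (Order.height_le_krullDim 𝔭).trans_eq hdim
    exact_mod_cast this
  choose h hh using fun 𝔭 ↦ ENat.ne_top_iff_exists.1
    ((hle 𝔭).trans_lt (ENat.natCast_lt_top d)).ne
  have hd (𝔭) : h 𝔭 ≤ d := by
    have := hle 𝔭
    rw [← hh] at this
    exact_mod_cast this
  refine ⟨fun 𝔭 ↦ d + 1 - h 𝔭, fun 𝔮 𝔭 hlt ↦ ?_, fun 𝔭 ↦ ?_, fun 𝔭 ↦ Nat.sub_le _ _⟩
  · have := Order.height_strictMono hlt ((hle 𝔮).trans_lt (ENat.natCast_lt_top d))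
    rw [← hh, ← hh] at this
    have : h 𝔮 < h 𝔭 := by exact_mod_cast this
    have := hd 𝔭
    dsimp only
    omega
  · have := hd 𝔭
    dsimp only
    omega

/-- If the rank of `P` exceeds `dim A`, the second component of a unimodular element of `A ⊕ P`
becomes unimodular after adding a multiple of the first. -/
theorem exists_unimodular_add_smul [IsNoetherianRing A] {d : ℕ} (hdim : ringKrullDim A = d)
    {P : Type*} [AddCommGroup P] [Module A P] [Module.Finite A P] [Module.Projective A P]
    (hrank : ∀ 𝔭 : PrimeSpectrum A, d < rankAtStalk P 𝔭)
    (u : A × P) (hu : ∃ f : (A × P) →ₗ[A] A, f u = 1) :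
    ∃ (q : P) (α : P →ₗ[A] A), α (u.2 + u.1 • q) = 1 := by
  obtain ⟨n, f, hf⟩ := Module.Finite.exists_fin' A P
  obtain ⟨g, hfg⟩ := Module.projective_lifting_property f LinearMap.id hf
  have hfg' (x : P) : f (g x) = x := LinearMap.congr_fun hfg x
  obtain ⟨δ, hδ, hpos, hδd⟩ := exists_strictAnti_of_ringKrullDim_eq hdim
  obtain ⟨φ, hφ⟩ := hu
  let m : Fin (n + 1) → Fin n → A := Fin.cons (g u.2) fun i ↦ g (f (Pi.single i 1))
  have hm (x : P) : g x ∈ Submodule.span A (Set.range m) := by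
    rw [← hfg' x, ← Finset.univ_sum_single (g x), map_sum, map_sum]
    refine sum_mem fun i _ ↦ ?_
    have : (Pi.single i (g x i) : Fin n → A) = g x i • Pi.single i 1 := by
      rw [← Pi.single_smul', smul_eq_mul, mul_one]
    rw [this, map_smul, map_smul]
    exact Submodule.smul_mem _ _ (Submodule.subset_span ⟨i.succ, rfl⟩)
  obtain ⟨w, hw, h⟩ := exists_forall_add_smul_notMem δ hδ hpos u.1 m
    (fun 𝔭 h𝔭 ↦ by
      by_contra! hcon
      have h1 : φ (1, 0) * u.1 + φ (0, u.2) = 1 := by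
        calc φ (1, 0) * u.1 + φ (0, u.2) = φ (u.1 • (1, 0) + (0, u.2)) := by
              rw [map_add, map_smul, smul_eq_mul, mul_comm]
          _ = 1 := by simpa using hφ
      have h2 : φ (0, u.2) ∈ 𝔭.asIdeal := by
        have : φ (0, u.2) = (φ ∘ₗ LinearMap.inr A A P ∘ₗ f) (g u.2) := by simp [hfg']
        rw [this, LinearMap.pi_apply_eq_sum_univ]
        exact sum_mem fun i _ ↦ Ideal.mul_mem_right _ _ (hcon i)
      exact 𝔭.2.ne_top ((Ideal.eq_top_iff_one _).2
        (h1 ▸ add_mem (Ideal.mul_mem_left _ _ h𝔭) h2)))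
    (fun 𝔭 ↦ by
      have h1 := finrank_fiber_le_fiberRank 𝔭 f g hfg m hm
      rw [← rankAtStalk_eq] at h1
      have := hrank 𝔭
      have := hδd 𝔭
      omega)
  have hwg : w = g (f w) := by
    have : Submodule.span A (Set.range m) ≤ LinearMap.eqLocus LinearMap.id (g ∘ₗ f) := by
      refine Submodule.span_le.2 ?_
      rintro _ ⟨i, rfl⟩
      induction i using Fin.cases <;> simp [m, hfg']
    exact this hw
  have hm0 : m 0 + u.1 • w = g (u.2 + u.1 • f w) := by
    rw [map_add, map_smul, ← hwg]; rfl
  rw [hm0] at h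
  have htop : Ideal.span (Set.range (g (u.2 + u.1 • f w))) = ⊤ := by
    by_contra hne
    obtain ⟨M, hM, hle⟩ := Ideal.exists_le_maximal _ hne
    obtain ⟨j, hj⟩ := h ⟨M, hM.isPrime⟩
    exact hj (hle (Ideal.subset_span ⟨j, rfl⟩))
  obtain ⟨c, hc⟩ := Ideal.mem_span_range_iff_exists_fun.1 ((Ideal.eq_top_iff_one _).1 htop)
  refine ⟨f w, (Fintype.linearCombination A c) ∘ₗ g, ?_⟩
  simpa [Fintype.linearCombination_apply, mul_comm] using hc

end

end

/-- The transvection `(b, q') ↦ (b, q' + b • q)`. -/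
def lowerTransvection {A P : Type*} [CommRing A] [AddCommGroup P] [Module A P] (q : P) :
    (A × P) ≃ₗ[A] (A × P) :=
  LinearEquiv.skewProd (LinearEquiv.refl A A) (LinearEquiv.refl A P)
    (LinearMap.toSpanSingleton A P q)

/-- The transvection `(b, q') ↦ (b + α q', q')`. -/
def upperTransvection {A P : Type*} [CommRing A] [AddCommGroup P] [Module A P] (α : P →ₗ[A] A) :
    (A × P) ≃ₗ[A] (A × P) where
  toFun x := (x.1 + α x.2, x.2)
  invFun x := (x.1 - α x.2, x.2)
  map_add' x y := by ext <;> simp; ring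
  map_smul' c x := by ext <;> simp [mul_add]
  left_inv x := by simp
  right_inv x := by simp

section

variable {A P : Type*} [CommRing A] [AddCommGroup P] [Module A P]

lemma lowerTransvection_apply (q : P) (x : A × P) :
    lowerTransvection q x = (x.1, x.2 + x.1 • q) := rfl

lemma upperTransvection_apply (α : P →ₗ[A] A) (x : A × P) :
    upperTransvection α x = (x.1 + α x.2, x.2) := rfl

lemma lowerTransvection_mem (q : P) : lowerTransvection q ∈ elementarySubgroup A P :=
  Subgroup.subset_closure (Or.inl ⟨q, lowerTransvection_apply q⟩)

lemma upperTransvection_mem (α : P →ₗ[A] A) : upperTransvection α ∈ elementarySubgroup A P :=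
  Subgroup.subset_closure (Or.inr ⟨α, upperTransvection_apply α⟩)

/-- If the second component becomes unimodular after adding a multiple of the first, the element
lies in the elementary orbit of `(1, 0)`. -/
lemma exists_mem_elementarySubgroup_apply_eq_one_zero (u : A × P) (q : P) (α : P →ₗ[A] A)
    (h : α (u.2 + u.1 • q) = 1) : ∃ e ∈ elementarySubgroup A P, e u = (1, 0) := by
  refine ⟨lowerTransvection (-(u.2 + u.1 • q)) * (upperTransvection ((1 - u.1) • α) *
    lowerTransvection q), mul_mem (lowerTransvection_mem _)
    (mul_mem (upperTransvection_mem _) (lowerTransvection_mem _)), ?_⟩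
  rw [LinearEquiv.mul_apply, LinearEquiv.mul_apply, lowerTransvection_apply q,
    upperTransvection_apply, lowerTransvection_apply]
  simp only [LinearMap.smul_apply, h, smul_eq_mul, mul_one, add_sub_cancel, one_smul,
    add_neg_cancel]

end

/-- Bass: `E(A ⊕ P)` acts transitively on `Um(A ⊕ P)` when `rank P > dim A`. -/
theorem bass_transitivity
    (A : Type*) [CommRing A] [IsNoetherianRing A] (d : ℕ)
    (hdim : ringKrullDim A = d)
    (P : Type*) [AddCommGroup P] [Module A P]
    [Module.Finite A P] [Module.Projective A P]
    (hrank : ∀ (𝔭 : Ideal A) [𝔭.IsPrime],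
      d < Module.finrank (Localization.AtPrime 𝔭) (LocalizedModule 𝔭.primeCompl P))
    (u v : A × P)
    (hu : ∃ f : (A × P) →ₗ[A] A, f u = 1)
    (hv : ∃ f : (A × P) →ₗ[A] A, f v = 1) :
    ∃ e ∈ elementarySubgroup A P, e u = v := by
  have key (w : A × P) (hw : ∃ f : (A × P) →ₗ[A] A, f w = 1) :
      ∃ e ∈ elementarySubgroup A P, e w = (1, 0) := by
    obtain ⟨q, α, h⟩ := exists_unimodular_add_smul hdim (fun 𝔭 ↦ hrank 𝔭.asIdeal) w hw
    exact exists_mem_elementarySubgroup_apply_eq_one_zero w q α h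
  obtain ⟨e₁, he₁, h₁⟩ := key u hu
  obtain ⟨e₂, he₂, h₂⟩ := key v hv
  refine ⟨e₂⁻¹ * e₁, mul_mem (inv_mem he₂) he₁, ?_⟩
  rw [LinearEquiv.mul_apply, h₁, ← h₂]
  exact e₂.symm_apply_apply v
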